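/- Suppose A is Γ-graded D-simple, and let 𝒥₀ ⊆ 𝒥. Then the sum Σ_{α∈𝒥₀} A d^α is direct if and only if the sum Σ_{α∈𝒥₀} F₁ d^α is direct, where a sum Σ_{α∈𝒥₀} B d^α (B ⊆ A) is called direct if every finite relation Σ_{α∈𝒥₀} b_α d^α = 0 with b_α ∈ B implies b_α d^α = 0 for all α. -/

import Mathlib

/-- A skew-symmetric bicharacter `ε : Γ × Γ → F^×`. -/
def IsBichar {F : Type} [Field F] {Γ : Type} [AddCommGroup Γ] (ε : Γ → Γ → F) : Prop :=
  (∀ lam mu, ε lam mu * ε mu lam = 1) ∧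
  (∀ lam mu nu, ε lam (mu + nu) = ε lam mu * ε lam nu)

variable (F : Type) [Field F] (Γ : Type) [AddCommGroup Γ] [DecidableEq Γ]
  (A : Type) [Ring A] [Algebra F A]

/-- left multiplication operators -/
noncomputable def mulL : A →ₗ[F] Module.End F A := (Algebra.lmul F A).toLinearMap

variable {F Γ A}

/-- `f ∈ End_F(A)` is homogeneous of degree `δ`. -/
def IsHomogMap (𝒜 : Γ → Submodule F A) (δ : Γ) (f : Module.End F A) : Prop :=
  ∀ lam : Γ, ∀ a ∈ 𝒜 lam, f a ∈ 𝒜 (lam + δ)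

/-- `f` is a homogeneous color-derivation of degree `δ`. -/
def IsColorDer (𝒜 : Γ → Submodule F A) (ε : Γ → Γ → F) (δ : Γ) (f : Module.End F A) : Prop :=
  IsHomogMap 𝒜 δ f ∧
  ∀ lam : Γ, ∀ a ∈ 𝒜 lam, ∀ b : A, f (a * b) = f a * b + ε δ lam • (a * f b)

/-- `Der^ε(A)`: the F-span of homogeneous color derivations. -/
def DerE (𝒜 : Γ → Submodule F A) (ε : Γ → Γ → F) : Submodule F (Module.End F A) :=
  Submodule.span F {f | ∃ δ, IsColorDer 𝒜 ε δ f}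

/-- `A` is ε-commutative. -/
def IsColorComm (𝒜 : Γ → Submodule F A) (ε : Γ → Γ → F) : Prop :=
  ∀ lam mu : Γ, ∀ a ∈ 𝒜 lam, ∀ b ∈ 𝒜 mu, a * b = ε lam mu • (b * a)

/-- `D` is color-commutative. -/
def DColorComm (𝒜 : Γ → Submodule F A) (ε : Γ → Γ → F) (D : Submodule F (Module.End F A)) : Prop :=
  ∀ δ δ' f g, f ∈ D → g ∈ D → IsColorDer 𝒜 ε δ f → IsColorDer 𝒜 ε δ' g →
    f * g = ε δ δ' • (g * f)

/-- `D` is a Γ-graded subspace: it is spanned by its homogeneous color-derivations. -/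
def DGraded (𝒜 : Γ → Submodule F A) (ε : Γ → Γ → F) (D : Submodule F (Module.End F A)) : Prop :=
  D = Submodule.span F {f | f ∈ D ∧ ∃ δ, IsColorDer 𝒜 ε δ f}

/-- `A[D]`: the unital subalgebra of `End_F(A)` generated by left multiplications and `D`. -/
noncomputable def AD (D : Submodule F (Module.End F A)) : Subalgebra F (Module.End F A) :=
  Algebra.adjoin F (Set.range (mulL F A) ∪ (D : Set (Module.End F A)))

/-- `A` is Γ-graded `D`-simple. -/
def GradedDSimple (𝒜 : Γ → Submodule F A) [GradedAlgebra 𝒜] (D : Submodule F (Module.End F A)) :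
    Prop :=
  ∀ I : Ideal A, Ideal.IsHomogeneous 𝒜 I → (∀ f ∈ D, ∀ x ∈ I, f x ∈ I) → I = ⊥ ∨ I = ⊤

/-- F₁ = A^D -/
def F1 (D : Submodule F (Module.End F A)) : Submodule F A where
  carrier := {u | ∀ f ∈ D, f u = 0}
  add_mem' := by
    intro a b ha hb f hf
    rw [map_add, ha f hf, hb f hf, add_zero]
  zero_mem' := by intro f hf; exact map_zero f
  smul_mem' := by
    intro c x hx f hf
    rw [map_smul, hx f hf, smul_zero]

/-- the derived space `W = [A[D], A[D]]`. -/
def Wsub (𝒜 : Γ → Submodule F A) (ε : Γ → Γ → F) (D : Submodule F (Module.End F A)) :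
    Submodule F (Module.End F A) :=
  Submodule.span F {w | ∃ γ γ' x y, x ∈ AD D ∧ y ∈ AD D ∧
    IsHomogMap 𝒜 γ x ∧ IsHomogMap 𝒜 γ' y ∧ w = x * y - ε γ γ' • (y * x)}

/-- `F₁[D]`. -/
noncomputable def F1D (D : Submodule F (Module.End F A)) : Subalgebra F (Module.End F A) :=
  Algebra.adjoin F ((mulL F A '' (F1 D : Set A)) ∪ (D : Set (Module.End F A)))

/-- `𝒟 = Der^ε(A) ∩ F₁[D]`. -/
def DScr (𝒜 : Γ → Submodule F A) (ε : Γ → Γ → F) (D : Submodule F (Module.End F A)) :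
    Set (Module.End F A) :=
  {f | f ∈ F1D D ∧ f ∈ DerE 𝒜 ε}

variable {I : Type} [LinearOrder I]

/-- ordered product `d^α`. -/
noncomputable def dpow (d : I → Module.End F A) (α : I →₀ ℕ) : Module.End F A :=
  ((α.support.sort (· ≤ ·)).map fun i => d i ^ α i).prod

/-- membership in the index set 𝒥. -/
def inJ (ε : Γ → Γ → F) (δd : I → Γ) (α : I →₀ ℕ) : Prop :=
  (∀ i, ringChar F ≠ 0 → α i ≤ ringChar F - 1) ∧
  (∀ i, ε (δd i) (δd i) = -1 → α i ≤ 1)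

/-- the degree of `d^α`. -/
def degJ (δd : I → Γ) (α : I →₀ ℕ) : Γ := α.sum fun i n => n • δd i

/-- the subalgebra `S` of `End_F(A)` is Γ-graded simple. -/
def GradedSimpleAlgOn (𝒜 : Γ → Submodule F A) (S : Subalgebra F (Module.End F A)) : Prop :=
  ∀ L : Submodule F (Module.End F A),
    L ≤ Subalgebra.toSubmodule S →
    (∀ x ∈ S, ∀ y ∈ L, x * y ∈ L ∧ y * x ∈ L) →
    L = Submodule.span F {f | f ∈ L ∧ ∃ δ, IsHomogMap 𝒜 δ f} →
    (L = ⊥ ∨ L = Subalgebra.toSubmodule S)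

/-- variant of 𝒥 without characteristic restriction -/
def inJ0 (ε : Γ → Γ → F) (δd : I → Γ) (α : I →₀ ℕ) : Prop :=
  ∀ i, ε (δd i) (δd i) = -1 → α i ≤ 1

/-- the sum `Σ_{α ∈ J0} B d^α` is direct -/
def DirectOn (d : I → Module.End F A) (J0 : Set (I →₀ ℕ)) (Bs : Set A) : Prop :=
  ∀ (s : Finset (I →₀ ℕ)) (c : (I →₀ ℕ) → A), ↑s ⊆ J0 → (∀ α ∈ s, c α ∈ Bs) →
    (∑ α ∈ s, mulL F A (c α) * dpow d α) = 0 → ∀ α ∈ s, mulL F A (c α) * dpow d α = 0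

/-- span of color brackets of homogeneous elements of `M` and `N` -/
def brkE (𝒜 : Γ → Submodule F A) (ε : Γ → Γ → F) (M N : Submodule F (Module.End F A)) :
    Submodule F (Module.End F A) :=
  Submodule.span F {w | ∃ γ γ' x y, x ∈ M ∧ y ∈ N ∧
    IsHomogMap 𝒜 γ x ∧ IsHomogMap 𝒜 γ' y ∧ w = x * y - ε γ γ' • (y * x)}

/-- The diagonal operator on `A` acting on `𝒜 lam` as the scalar `χ lam`. -/
noncomputable def gradedScale (𝒜 : Γ → Submodule F A) [GradedAlgebra 𝒜] (χ : Γ → F) :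
    Module.End F A :=
  (DirectSum.decomposeLinearEquiv 𝒜).symm.toLinearMap ∘ₗ
    DFinsupp.mapRange.linearMap (fun lam => χ lam • LinearMap.id) ∘ₗ
      (DirectSum.decomposeLinearEquiv 𝒜).toLinearMap

theorem decompose_gradedScale (𝒜 : Γ → Submodule F A) [GradedAlgebra 𝒜] (χ : Γ → F) (a : A)
    (lam : Γ) :
    DirectSum.decompose 𝒜 (gradedScale 𝒜 χ a) lam = χ lam • DirectSum.decompose 𝒜 a lam := by
  have h : DirectSum.decompose 𝒜 (gradedScale 𝒜 χ a) =
      DFinsupp.mapRange.linearMap (fun lam => χ lam • LinearMap.id) (DirectSum.decompose 𝒜 a) :=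
    (DirectSum.decompose 𝒜).apply_symm_apply _
  rw [h]
  rfl

theorem gradedScale_of_mem (𝒜 : Γ → Submodule F A) [GradedAlgebra 𝒜] (χ : Γ → F) {lam : Γ}
    {a : A} (ha : a ∈ 𝒜 lam) : gradedScale 𝒜 χ a = χ lam • a := by
  apply (DirectSum.decompose 𝒜).injective
  refine DFinsupp.ext fun mu => ?_
  rw [decompose_gradedScale, DirectSum.decompose_smul, DirectSum.smul_apply]
  by_cases h : lam = mu
  · rw [h]
  · have h0 : DirectSum.decompose 𝒜 a mu = 0 :=
      Subtype.ext (DirectSum.decompose_of_mem_ne 𝒜 ha h)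
    rw [h0, smul_zero, smul_zero]

theorem gradedScale_injective (𝒜 : Γ → Submodule F A) [GradedAlgebra 𝒜] {χ : Γ → F}
    (hχ : ∀ lam, χ lam ≠ 0) : Function.Injective (gradedScale 𝒜 χ) := by
  intro a b hab
  apply (DirectSum.decompose 𝒜).injective
  refine DFinsupp.ext fun mu => ?_
  have h := decompose_gradedScale 𝒜 χ a mu
  rw [hab, decompose_gradedScale] at h
  exact (smul_right_injective _ (hχ mu) h).symm

theorem gradedScale_mul (𝒜 : Γ → Submodule F A) [GradedAlgebra 𝒜] {χ : Γ → F}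
    (hχ : ∀ lam mu, χ (lam + mu) = χ lam * χ mu) (a b : A) :
    gradedScale 𝒜 χ (a * b) = gradedScale 𝒜 χ a * gradedScale 𝒜 χ b := by
  induction a using DirectSum.Decomposition.inductionOn 𝒜 with
  | zero => simp
  | add x y hx hy => rw [add_mul, map_add, hx, hy, map_add, add_mul]
  | homogeneous x =>
    induction b using DirectSum.Decomposition.inductionOn 𝒜 with
    | zero => simp
    | add x y hx hy => rw [mul_add, map_add, hx, hy, map_add, mul_add]
    | homogeneous y =>
      rw [gradedScale_of_mem 𝒜 χ (SetLike.mul_mem_graded x.2 y.2), gradedScale_of_mem 𝒜 χ x.2,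
        gradedScale_of_mem 𝒜 χ y.2, hχ, smul_mul_smul_comm]

theorem mulL_apply (a b : A) : mulL F A a b = a * b := rfl

theorem IsBichar.ne_zero {ε : Γ → Γ → F} (h : IsBichar ε) (lam mu : Γ) : ε lam mu ≠ 0 :=
  left_ne_zero_of_mul_eq_one (h.1 lam mu)

theorem IsBichar.add_left {ε : Γ → Γ → F} (h : IsBichar ε) (lam mu nu : Γ) :
    ε (lam + mu) nu = ε lam nu * ε mu nu := by
  have h1 := h.1 (lam + mu) nu
  rw [h.2] at h1
  apply mul_right_cancel₀ (mul_ne_zero (h.ne_zero nu lam) (h.ne_zero nu mu))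
  rw [h1, mul_mul_mul_comm, h.1, h.1, one_mul]

theorem IsBichar.zero_right {ε : Γ → Γ → F} (h : IsBichar ε) (lam : Γ) : ε lam 0 = 1 := by
  have h1 := h.2 lam 0 0
  rw [add_zero] at h1
  exact (mul_eq_left₀ (h.ne_zero lam 0)).mp h1.symm

theorem IsColorDer.map_one {𝒜 : Γ → Submodule F A} [GradedAlgebra 𝒜] {ε : Γ → Γ → F}
    (hε : IsBichar ε) {δ : Γ} {f : Module.End F A} (hf : IsColorDer 𝒜 ε δ f) : f 1 = 0 := by
  have h := hf.2 0 1 SetLike.GradedOne.one_mem 1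
  rw [hε.zero_right, one_smul, one_mul, mul_one, one_mul] at h
  exact left_eq_add.mp h

/-- Rescaling a color derivation of degree `δ` by `ε(·, δ)` turns it into a skew derivation. -/
theorem IsColorDer.gradedScale_map_mul {𝒜 : Γ → Submodule F A} [GradedAlgebra 𝒜]
    {ε : Γ → Γ → F} (hε : IsBichar ε) {δ : Γ} {f : Module.End F A} (hf : IsColorDer 𝒜 ε δ f)
    (a b : A) :
    gradedScale 𝒜 (ε · δ) (f (a * b)) =
      gradedScale 𝒜 (ε · δ) (f a * b) + a * gradedScale 𝒜 (ε · δ) (f b) := by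
  induction a using DirectSum.Decomposition.inductionOn 𝒜 with
  | zero => simp
  | add x y hx hy =>
    simp only [add_mul, map_add, hx, hy]
    abel
  | @homogeneous lam x =>
    have hmul := gradedScale_mul 𝒜 (χ := (ε · δ)) (fun lam mu => hε.add_left lam mu δ)
    rw [hf.2 lam x x.2 b, map_add, map_smul, hmul (x : A) (f b),
      gradedScale_of_mem 𝒜 (ε · δ) x.2, smul_mul_assoc, smul_smul, hε.1, one_smul]

/-- The rescaled operator of a homogeneous `f ∈ D` commutes with all of `F₁[D]`. -/
theorem commute_gradedScale_mul_of_mem_F1D {𝒜 : Γ → Submodule F A} [GradedAlgebra 𝒜]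
    {ε : Γ → Γ → F} (hε : IsBichar ε) {D : Submodule F (Module.End F A)}
    (hDgr : DGraded 𝒜 ε D) (hDcc : DColorComm 𝒜 ε D) {δ : Γ} {f : Module.End F A}
    (hfD : f ∈ D) (hf : IsColorDer 𝒜 ε δ f) {x : Module.End F A} (hx : x ∈ F1D D) :
    gradedScale 𝒜 (ε · δ) * f * x = x * (gradedScale 𝒜 (ε · δ) * f) := by
  set E := gradedScale 𝒜 (ε · δ) * f with hE
  suffices h : F1D D ≤ Subalgebra.centralizer F {E} from
    Subalgebra.mem_centralizer_iff F |>.mp (h hx) E rfl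
  have hD : D ≤ Subalgebra.toSubmodule (Subalgebra.centralizer F {E}) := by
    rw [hDgr, Submodule.span_le]
    rintro g ⟨hgD, δ', hg⟩
    refine Subalgebra.mem_centralizer_iff F |>.mpr ?_
    rintro _ rfl
    refine LinearMap.ext fun a => ?_
    induction a using DirectSum.Decomposition.inductionOn 𝒜 with
    | zero => simp
    | add x y hx hy => rw [map_add, hx, hy, map_add]
    | @homogeneous lam a =>
      have hfg : f (g a) = ε δ δ' • g (f a) :=
        LinearMap.congr_fun (hDcc δ δ' f g hfD hgD hf hg) (a : A)
      simp only [hE, Module.End.mul_apply]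
      rw [gradedScale_of_mem 𝒜 (ε · δ) (hf.1 _ _ (hg.1 _ _ a.2)),
        gradedScale_of_mem 𝒜 (ε · δ) (hf.1 _ _ a.2), map_smul, hfg, smul_smul]
      congr 1
      simp only [hε.add_left]
      linear_combination (ε lam δ * ε δ δ) * hε.1 δ' δ
  refine Algebra.adjoin_le (Set.union_subset ?_ hD)
  rintro _ ⟨u, hu, rfl⟩
  refine Subalgebra.mem_centralizer_iff F |>.mpr ?_
  rintro _ rfl
  refine LinearMap.ext fun b => ?_
  simp only [hE, Module.End.mul_apply, mulL_apply]
  rw [hf.gradedScale_map_mul hε, hu f hfD, zero_mul, map_zero, zero_add]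

/-- Differentiating the coefficients of an operator relation along `D` gives a relation. -/
theorem sum_mulL_map_mul_eq_zero {ι : Type*} {𝒜 : Γ → Submodule F A} [GradedAlgebra 𝒜]
    {ε : Γ → Γ → F} (hε : IsBichar ε) {D : Submodule F (Module.End F A)}
    (hDgr : DGraded 𝒜 ε D) (hDcc : DColorComm 𝒜 ε D) {x : ι → Module.End F A}
    (hx : ∀ i, x i ∈ F1D D) {s : Finset ι} {c : ι → A}
    (hc : ∑ i ∈ s, mulL F A (c i) * x i = 0) {f : Module.End F A} (hf : f ∈ D) :
    ∑ i ∈ s, mulL F A (f (c i)) * x i = 0 := by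
  rw [hDgr] at hf
  induction hf using Submodule.span_induction with
  | zero => simp
  | add f g _ _ hf hg =>
    simp only [LinearMap.add_apply, map_add, add_mul, Finset.sum_add_distrib, hf, hg, add_zero]
  | smul r f _ hf =>
    simp only [LinearMap.smul_apply, map_smul, smul_mul_assoc, ← Finset.smul_sum, hf, smul_zero]
  | mem f hf =>
    obtain ⟨hfD, δ, hf⟩ := hf
    refine LinearMap.ext fun b => ?_
    apply gradedScale_injective 𝒜 (χ := (ε · δ)) (fun lam => hε.ne_zero lam δ)
    have hrel : ∀ b, ∑ i ∈ s, c i * x i b = 0 := fun b => by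
      simpa [LinearMap.sum_apply, mulL_apply] using LinearMap.congr_fun hc b
    have hcomm : ∀ i, gradedScale 𝒜 (ε · δ) (f (x i b)) = x i (gradedScale 𝒜 (ε · δ) (f b)) :=
      fun i => LinearMap.congr_fun
        (commute_gradedScale_mul_of_mem_F1D hε hDgr hDcc hfD hf (hx i)) b
    have h : gradedScale 𝒜 (ε · δ) (f (∑ i ∈ s, c i * x i b)) = 0 := by
      rw [hrel b, map_zero, map_zero]
    simp only [map_sum, hf.gradedScale_map_mul hε, Finset.sum_add_distrib, hcomm] at h
    rw [hrel, add_zero] at h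
    simpa [LinearMap.sum_apply, mulL_apply, map_sum] using h

/-- The homogeneous components of a relation among homogeneous operators are relations. -/
theorem sum_mulL_decompose_mul_eq_zero {ι : Type*} {𝒜 : Γ → Submodule F A} [GradedAlgebra 𝒜]
    {x : ι → Module.End F A} {g : ι → Γ} (hx : ∀ i, IsHomogMap 𝒜 (g i) (x i)) {s : Finset ι}
    {c : ι → A} (hc : ∑ i ∈ s, mulL F A (c i) * x i = 0) (γ : Γ) :
    ∑ i ∈ s, mulL F A (DirectSum.decompose 𝒜 (c i) (γ - g i)) * x i = 0 := by
  refine LinearMap.ext fun b => ?_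
  induction b using DirectSum.Decomposition.inductionOn 𝒜 with
  | zero => simp
  | add y z hy hz => rw [map_add, hy, hz, map_add]
  | @homogeneous lam b =>
    have h : ∑ i ∈ s, c i * x i b = 0 := by
      simpa [LinearMap.sum_apply, mulL_apply] using LinearMap.congr_fun hc (b : A)
    have h' := congrArg (GradedRing.proj 𝒜 (γ + lam)) h
    rw [map_sum, map_zero] at h'
    simp only [LinearMap.sum_apply, Module.End.mul_apply, mulL_apply, LinearMap.zero_apply]
    rw [← h']
    refine Finset.sum_congr rfl fun i _ => ?_
    rw [GradedRing.proj_apply, show γ + lam = (γ - g i) + (lam + g i) by abel,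
      DirectSum.coe_decompose_mul_add_of_right_mem 𝒜 (hx i lam b b.2)]

/-- In the graded `D`-simple case, a relation with a nonzero coefficient at `j` can be replaced
by one whose coefficient at `j` is `1`. -/
theorem exists_relation_apply_eq_one {ι : Type*} {𝒜 : Γ → Submodule F A} [GradedAlgebra 𝒜]
    {ε : Γ → Γ → F} (hε : IsBichar ε) {D : Submodule F (Module.End F A)}
    (hDgr : DGraded 𝒜 ε D) (hDcc : DColorComm 𝒜 ε D) (hsimple : GradedDSimple 𝒜 D)
    {x : ι → Module.End F A} (hx : ∀ i, x i ∈ F1D D) {g : ι → Γ}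
    (hg : ∀ i, IsHomogMap 𝒜 (g i) (x i)) {s : Finset ι} {c : ι → A}
    (hc : ∑ i ∈ s, mulL F A (c i) * x i = 0) {j : ι} (hj : c j ≠ 0) :
    ∃ c' : ι → A, ∑ i ∈ s, mulL F A (c' i) * x i = 0 ∧ c' j = 1 := by
  let J : Ideal A :=
    { carrier := {a | ∃ c' : ι → A, ∑ i ∈ s, mulL F A (c' i) * x i = 0 ∧ c' j = a}
      zero_mem' := ⟨0, by simp, rfl⟩
      add_mem' := by
        rintro _ _ ⟨c₁, h₁, rfl⟩ ⟨c₂, h₂, rfl⟩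
        exact ⟨c₁ + c₂, by simp [add_mul, Finset.sum_add_distrib, h₁, h₂], rfl⟩
      smul_mem' := by
        rintro r _ ⟨c₁, h₁, rfl⟩
        refine ⟨fun i => r * c₁ i, ?_, rfl⟩
        have hmul : ∀ a, mulL F A (r * a) = mulL F A r * mulL F A a :=
          fun a => map_mul (Algebra.lmul F A) r a
        simp only [hmul, mul_assoc, ← Finset.mul_sum, h₁, mul_zero] }
  have hJ : J = ⊥ ∨ J = ⊤ := by
    refine hsimple J ?_ ?_
    · rintro γ _ ⟨c₁, h₁, rfl⟩
      exact ⟨_, sum_mulL_decompose_mul_eq_zero hg h₁ (γ + g j), by rw [add_sub_cancel_right]⟩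
    · rintro f hf _ ⟨c₁, h₁, rfl⟩
      exact ⟨_, sum_mulL_map_mul_eq_zero hε hDgr hDcc hx h₁ hf, rfl⟩
  rcases hJ with hJ | hJ
  · exact absurd ((Submodule.eq_bot_iff J).mp hJ (c j) ⟨c, hc, rfl⟩) hj
  · exact (Ideal.eq_top_iff_one J).mp hJ

/-- If relations over `F₁` among homogeneous elements of `F₁[D]` are trivial, so are all
relations over `A`. -/
theorem relation_trivial_of_F1 {ι : Type*} {𝒜 : Γ → Submodule F A} [GradedAlgebra 𝒜]
    {ε : Γ → Γ → F} (hε : IsBichar ε) {D : Submodule F (Module.End F A)}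
    (hDgr : DGraded 𝒜 ε D) (hDcc : DColorComm 𝒜 ε D) (hsimple : GradedDSimple 𝒜 D)
    {x : ι → Module.End F A} (hx : ∀ i, x i ∈ F1D D) {g : ι → Γ}
    (hg : ∀ i, IsHomogMap 𝒜 (g i) (x i)) (s : Finset ι)
    (hs : ∀ (t : Finset ι) (c : ι → A), t ⊆ s → (∀ i ∈ t, c i ∈ F1 D) →
      ∑ i ∈ t, mulL F A (c i) * x i = 0 → ∀ i ∈ t, mulL F A (c i) * x i = 0)
    (c : ι → A) (hc : ∑ i ∈ s, mulL F A (c i) * x i = 0) :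
    ∀ i ∈ s, mulL F A (c i) * x i = 0 := by
  classical
  have mulL_one : mulL F A 1 = 1 := map_one (Algebra.lmul F A)
  have hone : ∀ f ∈ D, f 1 = 0 := by
    intro f hf
    rw [hDgr] at hf
    induction hf using Submodule.span_induction with
    | zero => rfl
    | add f g _ _ hf hg => rw [LinearMap.add_apply, hf, hg, add_zero]
    | smul r f _ hf => rw [LinearMap.smul_apply, hf, smul_zero]
    | mem f hf =>
      obtain ⟨-, δ, hf⟩ := hf
      exact hf.map_one hε
  have hann : ∀ i a, mulL F A a * x i = 0 → x i ≠ 0 → a = 0 := by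
    intro i a h hxi
    by_contra ha
    obtain ⟨c', h', h1⟩ := exists_relation_apply_eq_one hε hDgr hDcc hsimple hx hg
      (s := {i}) (c := fun _ => a) (by simpa using h) (j := i) ha
    rw [Finset.sum_singleton, h1, mulL_one, one_mul] at h'
    exact hxi h'
  induction s using Finset.strongInduction generalizing c with
  | H s ih =>
    intro j hj
    by_contra hne
    have hcj : c j ≠ 0 := fun h => hne (by rw [h, map_zero, zero_mul])
    have hxj : x j ≠ 0 := fun h => hne (by rw [h, mul_zero])
    obtain ⟨c', hc', hc'j⟩ := exists_relation_apply_eq_one hε hDgr hDcc hsimple hx hg hc hcj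
    have hder : ∀ f ∈ D, ∀ i ∈ s, mulL F A (f (c' i)) * x i = 0 := by
      intro f hf i hi
      have h := sum_mulL_map_mul_eq_zero hε hDgr hDcc hx hc' hf
      have h0 : mulL F A (f (c' j)) * x j = 0 := by
        rw [hc'j, hone f hf, map_zero, zero_mul]
      rw [← Finset.add_sum_erase s _ hj, h0, zero_add] at h
      by_cases hij : i = j
      · rw [hij, h0]
      · exact ih (s.erase j) (Finset.erase_ssubset hj)
          (fun t c ht => hs t c (ht.trans (Finset.erase_subset j s))) _ h i
          (Finset.mem_erase.mpr ⟨hij, hi⟩)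
    have hfin := hs s (fun i => if x i = 0 then 0 else c' i) subset_rfl
      (fun i hi => by
        split_ifs with hxi
        · exact zero_mem _
        · exact fun f hf => hann i _ (hder f hf i hi) hxi)
      (by
        refine (Finset.sum_congr rfl fun i _ => ?_).trans hc'
        split_ifs with hxi
        · rw [hxi, mul_zero, mul_zero]
        · rfl) j hj
    rw [if_neg hxj, hc'j, mulL_one, one_mul] at hfin
    exact hxj hfin

theorem IsHomogMap.one (𝒜 : Γ → Submodule F A) : IsHomogMap 𝒜 0 1 := fun lam a ha => by
  rw [add_zero]
  exact ha

theorem IsHomogMap.mul {𝒜 : Γ → Submodule F A} {δ δ' : Γ} {f g : Module.End F A}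
    (hf : IsHomogMap 𝒜 δ f) (hg : IsHomogMap 𝒜 δ' g) : IsHomogMap 𝒜 (δ' + δ) (f * g) :=
  fun lam a ha => by
    rw [← add_assoc]
    exact hf _ _ (hg _ _ ha)

theorem exists_isHomogMap_list_prod {𝒜 : Γ → Submodule F A} (l : List (Module.End F A))
    (hl : ∀ f ∈ l, ∃ δ, IsHomogMap 𝒜 δ f) : ∃ δ, IsHomogMap 𝒜 δ l.prod :=
  List.prod_induction _ (fun _ _ ⟨_, hf⟩ ⟨_, hg⟩ => ⟨_, hf.mul hg⟩) ⟨0, IsHomogMap.one 𝒜⟩ hl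

theorem exists_isHomogMap_dpow {𝒜 : Γ → Submodule F A} {d : I → Module.End F A} {δd : I → Γ}
    (hd : ∀ i, IsHomogMap 𝒜 (δd i) (d i)) (α : I →₀ ℕ) : ∃ δ, IsHomogMap 𝒜 δ (dpow d α) := by
  refine exists_isHomogMap_list_prod _ fun f hf => ?_
  obtain ⟨i, -, rfl⟩ := List.mem_map.mp hf
  rw [← List.prod_replicate]
  refine exists_isHomogMap_list_prod _ fun f hf => ?_
  exact ⟨δd i, List.eq_of_mem_replicate hf ▸ hd i⟩

theorem dpow_mem {d : I → Module.End F A} {S : Subalgebra F (Module.End F A)}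
    (hd : ∀ i, d i ∈ S) (α : I →₀ ℕ) : dpow d α ∈ S := by
  refine list_prod_mem fun f hf => ?_
  obtain ⟨i, -, rfl⟩ := List.mem_map.mp hf
  exact pow_mem (hd i) _

theorem stmt_6
    (𝒜 : Γ → Submodule F A) [GradedAlgebra 𝒜] (ε : Γ → Γ → F)
    (D : Submodule F (Module.End F A))
    (hchar : (2 : F) ≠ 0)
    (hbich : IsBichar ε)
    (hcomm : IsColorComm 𝒜 ε)
    (hDder : D ≤ DerE 𝒜 ε)
    (hDgr : DGraded 𝒜 ε D)
    (hDcc : DColorComm 𝒜 ε D)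
    (hDne : D ≠ ⊥)
    (hsimple : GradedDSimple 𝒜 D)
    (d : I → Module.End F A) (δd : I → Γ)
    (hdD : ∀ i, d i ∈ DScr 𝒜 ε D)
    (hdhom : ∀ i, IsColorDer 𝒜 ε (δd i) (d i))
    (hdspan : ∀ f ∈ DScr 𝒜 ε D, ∃ (s : Finset I) (c : I → A),
      (∀ i, c i ∈ F1 D) ∧ f = ∑ i ∈ s, mulL F A (c i) * d i)
    (hdind : ∀ (s : Finset I) (c : I → A), (∀ i, c i ∈ F1 D) →
      (∑ i ∈ s, mulL F A (c i) * d i) = 0 → ∀ i ∈ s, c i = 0)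
    :
    ∀ J0 : Set (I →₀ ℕ), J0 ⊆ {α | inJ ε δd α} →
      (DirectOn d J0 Set.univ ↔ DirectOn d J0 (F1 D : Set A)) := by
  intro J0 _
  refine ⟨fun h s c hs _ => h s c hs fun _ _ => Set.mem_univ _, fun h s c hs _ hc => ?_⟩
  choose g hg using exists_isHomogMap_dpow fun i => (hdhom i).1
  exact relation_trivial_of_F1 hbich hDgr hDcc hsimple (dpow_mem fun i => (hdD i).1) hg s
    (fun t c' ht => h t c' ((Finset.coe_subset.mpr ht).trans hs)) c hc
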